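/- Fix indices i ≠ j in {1,…,l} and let v ∈ ℝ^I be the vector with coordinates v_{(i)} = m_j·√(d_i), v_{(j)} = −m_i·√(d_j), v_{(k)} = 0 for k ∉ {i,j}, v_{(ij)} = ((m_j−m_i)/2)·√(m_i·m_j), v_{(ih)} = (m_j/2)·√(m_i·m_h) for h ∉ {i,j}, v_{(jh)} = −(m_i/2)·√(m_j·m_h) for h ∉ {i,j}, and v_{(hk)} = 0 when h,k ∉ {i,j}. Then M·v = (m/(2(m−2)))·v, i.e., v is an eigenvector of M with eigenvalue m/(2(m−2)). -/

import Mathlib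

open Finset

/-- The index set: `l` symbols `(i)` together with the unordered pairs `(ij)`, `i ≠ j`. -/
abbrev WZIndex (l : ℕ) := Fin l ⊕ {s : Finset (Fin l) // s.card = 2}

/-- The matrix of the Lichnerowicz Laplacian of the standard Einstein metric of the spaces
`SO(m)/K₁×⋯×K_l` (Wang–Ziller's conceptual construction, no Grassmannians or spheres). -/
noncomputable def WZMatrix (l : ℕ) (mm : Fin l → ℝ) (κ : ℝ) :
    Matrix (WZIndex l) (WZIndex l) ℝ :=
  let m : ℝ := ∑ i, mm i
  let d : Fin l → ℝ := fun i => mm i * (mm i - 1) / 2 - κ * mm i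
  fun p q =>
    match p, q with
    | Sum.inl i, Sum.inl j => if i = j then (m - mm i) / (m - 2) else 0
    | Sum.inl i, Sum.inr s =>
        if i ∈ s.1 then
          -Real.sqrt (d i * (∑ h ∈ s.1.erase i, mm h) / mm i) / (m - 2)
        else 0
    | Sum.inr s, Sum.inl i =>
        if i ∈ s.1 then
          -Real.sqrt (d i * (∑ h ∈ s.1.erase i, mm h) / mm i) / (m - 2)
        else 0
    | Sum.inr s, Sum.inr t =>
        if s = t then
          (m - (∑ h ∈ s.1, mm h) + ∑ h ∈ s.1, d h / mm h) / (m - 2)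
        else if (s.1 ∩ t.1).card = 1 then
          -Real.sqrt ((∑ h ∈ s.1 \ t.1, mm h) * (∑ h ∈ t.1 \ s.1, mm h)) / (2 * (m - 2))
        else 0

theorem wz_sum_mem {l : ℕ} (a : Fin l) (F : Finset (Fin l) → ℝ) :
    ∑ s : {s : Finset (Fin l) // s.card = 2}, (if a ∈ s.1 then F s.1 else 0)
      = ∑ b ∈ univ.erase a, F {a, b} := by
  rw [← Finset.sum_filter]
  symm
  refine Finset.sum_bij (fun b hb => ⟨{a, b}, Finset.card_pair (Finset.ne_of_mem_erase hb).symm⟩)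
    ?_ ?_ ?_ ?_
  · intro b hb; simp
  · intro b hb b' hb' h
    have h' : ({a, b} : Finset (Fin l)) = {a, b'} := congrArg Subtype.val h
    have h1 : b ∈ ({a, b'} : Finset (Fin l)) := h' ▸ (by simp)
    have h2 : b ≠ a := Finset.ne_of_mem_erase hb
    simpa [h2] using h1
  · rintro ⟨s, hs⟩ h
    have ha : a ∈ s := by simpa using h
    obtain ⟨x, y, hxy, rfl⟩ := Finset.card_eq_two.1 hs
    simp only [mem_insert, mem_singleton] at ha
    rcases ha with rfl | rfl
    · exact ⟨y, by simp [hxy.symm], rfl⟩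
    · exact ⟨x, by simp [hxy], Subtype.ext (Finset.pair_comm _ _)⟩
  · intro b hb; rfl

theorem wz_sum_row {l : ℕ} (a b : Fin l) (hab : a ≠ b) (F : Finset (Fin l) → ℝ)
    (hF : ∀ t : Finset (Fin l), t.card = 2 → a ∉ t → b ∉ t → F t = 0) :
    ∑ s : {s : Finset (Fin l) // s.card = 2}, F s.1
      = F {a, b} + ∑ k ∈ (univ.erase a).erase b, (F {a, k} + F {b, k}) := by
  have h1 := wz_sum_mem a F
  have h2 := wz_sum_mem b (fun t => if a ∈ t then 0 else F t)
  have h3 : ∑ s : {s : Finset (Fin l) // s.card = 2}, F s.1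
      = ∑ s : {s : Finset (Fin l) // s.card = 2}, (if a ∈ s.1 then F s.1 else 0)
       + ∑ s : {s : Finset (Fin l) // s.card = 2},
          (if b ∈ s.1 then (if a ∈ s.1 then 0 else F s.1) else 0) := by
    rw [← Finset.sum_add_distrib]
    refine Finset.sum_congr rfl fun s _ => ?_
    by_cases ha : a ∈ s.1 <;> by_cases hb : b ∈ s.1 <;> simp [ha, hb]
    exact hF _ s.2 ha hb
  rw [h3, h1, h2, Finset.sum_add_distrib, ← add_assoc,
    ← Finset.add_sum_erase (univ.erase a) _ (show b ∈ univ.erase a by simp [hab.symm]),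
    ← Finset.add_sum_erase (univ.erase b) _ (show a ∈ univ.erase b by simp [hab])]
  simp only [mem_insert, mem_singleton, or_true, if_true, zero_add]
  rw [Finset.erase_right_comm (a := b)]
  congr 1
  refine Finset.sum_congr rfl fun k hk => ?_
  have : a ≠ k := by
    rintro rfl
    simp at hk
  simp [this, hab]

/-- For fixed `i ≠ j`, the displayed vector `v` is an eigenvector of the
above matrix with eigenvalue `m/(2(m-2))`. -/
theorem stmt15 (l : ℕ) (hl : 2 ≤ l) (mm : Fin l → ℝ) (κ : ℝ)
    (hmm : ∀ i, 0 < mm i) (hm : 2 < ∑ i, mm i)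
    (hd : ∀ i, 0 < mm i * (mm i - 1) / 2 - κ * mm i)
    (i j : Fin l) (hij : i ≠ j)
    (v : WZIndex l → ℝ)
    (hv : v = fun p =>
      match p with
      | Sum.inl a =>
          if a = i then mm j * Real.sqrt (mm i * (mm i - 1) / 2 - κ * mm i)
          else if a = j then -(mm i) * Real.sqrt (mm j * (mm j - 1) / 2 - κ * mm j)
          else 0
      | Sum.inr s =>
          if i ∈ s.1 ∧ j ∈ s.1 then
            ((mm j - mm i) / 2) * Real.sqrt (mm i * mm j)
          else if i ∈ s.1 then
            (mm j / 2) * Real.sqrt (mm i * (∑ h ∈ s.1.erase i, mm h))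
          else if j ∈ s.1 then
            -(mm i / 2) * Real.sqrt (mm j * (∑ h ∈ s.1.erase j, mm h))
          else 0) :
    (WZMatrix l mm κ).mulVec v = ((∑ i, mm i) / (2 * ((∑ i, mm i) - 2))) • v := by
  obtain ⟨m, hmdef⟩ : ∃ m, m = ∑ i, mm i := ⟨_, rfl⟩
  obtain ⟨d, hddef⟩ : ∃ d : Fin l → ℝ, d = fun i => mm i * (mm i - 1) / 2 - κ * mm i := ⟨_, rfl⟩
  obtain ⟨c, hc⟩ : ∃ c : Fin l → ℝ, c = fun a => if a = i then mm j else if a = j then -mm i else 0 :=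
    ⟨_, rfl⟩
  obtain ⟨r, hr⟩ : ∃ r : Fin l → ℝ, r = fun a => Real.sqrt (mm a) := ⟨_, rfl⟩
  obtain ⟨e, he⟩ : ∃ e : Fin l → ℝ, e = fun a => Real.sqrt (d a) := ⟨_, rfl⟩
  have hci : c i = mm j := by simp [hc]
  have hcj : c j = -mm i := by simp [hc, hij.symm]
  have hc0 : ∀ a, a ≠ i → a ≠ j → c a = 0 := fun a h1 h2 => by simp [hc, h1, h2]
  have hcm : ∑ a, mm a * c a = 0 := by
    rw [← Finset.add_sum_erase univ _ (mem_univ i),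
      ← Finset.add_sum_erase (univ.erase i) _ (show j ∈ univ.erase i by simp [hij.symm]),
      Finset.sum_eq_zero, hci, hcj]
    · ring
    · intro a ha
      simp only [mem_erase, mem_univ, and_true] at ha
      rw [hc0 a ha.2 ha.1, mul_zero]
  have hdpos : ∀ a, 0 < d a := fun a => by simpa [hddef] using hd a
  have hrr : ∀ a, r a * r a = mm a := fun a => by rw [hr]; exact Real.mul_self_sqrt (hmm a).le
  have hee : ∀ a, e a * e a = d a := fun a => by rw [he]; exact Real.mul_self_sqrt (hdpos a).le
  have hrpos : ∀ a, 0 < r a := fun a => by rw [hr]; exact Real.sqrt_pos.2 (hmm a)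
  have hsq : ∀ a b, Real.sqrt (mm a * mm b) = r a * r b := fun a b => by
    rw [hr]; exact Real.sqrt_mul (hmm a).le _
  have hsq2 : ∀ a b, Real.sqrt (d a * mm b / mm a) = e a * r b / r a := fun a b => by
    rw [hr, he, Real.sqrt_div (mul_nonneg (hdpos a).le (hmm b).le), Real.sqrt_mul (hdpos a).le]
  have hm2 : m - 2 ≠ 0 := by rw [hmdef]; linarith
  -- the vector
  have hva : ∀ a, v (Sum.inl a) = c a * e a := by
    intro a
    rw [hv, hc, he, hddef]
    by_cases h1 : a = i
    · subst h1; simp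
    · by_cases h2 : a = j
      · subst h2; simp [h1]
      · simp [h1, h2]
  obtain ⟨V, hV⟩ : ∃ V : Finset (Fin l) → ℝ, V = fun s =>
          if i ∈ s ∧ j ∈ s then
            ((mm j - mm i) / 2) * Real.sqrt (mm i * mm j)
          else if i ∈ s then
            (mm j / 2) * Real.sqrt (mm i * (∑ h ∈ s.erase i, mm h))
          else if j ∈ s then
            -(mm i / 2) * Real.sqrt (mm j * (∑ h ∈ s.erase j, mm h))
          else 0 := ⟨_, rfl⟩
  have hvs : ∀ s, v (Sum.inr s) = V s.1 := fun s => by rw [hv, hV]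
  have er1 : ∀ a b : Fin l, a ≠ b → ({a, b} : Finset (Fin l)).erase a = {b} := by
    intro a b h; ext x; simp; grind
  have er2 : ∀ a b : Fin l, a ≠ b → ({a, b} : Finset (Fin l)).erase b = {a} := by
    intro a b h; ext x; simp; grind
  have hVab : ∀ a b, a ≠ b → V {a, b} = (c a + c b) / 2 * (r a * r b) := by
    intro a b hab
    rw [hV]
    simp only [mem_insert, mem_singleton]
    by_cases hai : a = i
    · subst hai
      by_cases hbj : b = j
      · subst hbj; simp [hci, hcj, hsq]; left; ring
      · have := hc0 b (Ne.symm hab) hbj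
        simp [hij.symm, Ne.symm hbj, er1 a b hab, hsq, hci, this]
    by_cases haj : a = j
    · subst haj
      by_cases hbi : b = i
      · subst hbi; simp [hci, hcj, hsq]; ring
      · have := hc0 b hbi (Ne.symm hab)
        simp [hij, Ne.symm hbi, er1 a b hab, hsq, hcj, this]; ring
    have h0 := hc0 a hai haj
    by_cases hbi : b = i
    · subst hbi
      simp [Ne.symm hai, Ne.symm haj, hij.symm, er2 a b hab, hsq, hci, h0]; left; ring
    by_cases hbj : b = j
    · subst hbj
      simp [Ne.symm hai, Ne.symm haj, hij, er2 a b hab, hsq, hcj, h0]; ring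
    have h0' := hc0 b hbi hbj
    simp [Ne.symm hai, Ne.symm haj, Ne.symm hbi, Ne.symm hbj, h0, h0']
  rw [← hmdef]
  funext p
  simp only [Matrix.mulVec, dotProduct, Fintype.sum_sum_type, Pi.smul_apply, smul_eq_mul, hva, hvs]
  rcases p with a | ⟨s, hs⟩
  · rw [hva]
    simp only [WZMatrix, ← hmdef, ite_mul, zero_mul, Finset.sum_ite_eq, mem_univ, if_true]
    have key := wz_sum_mem a (fun s => -Real.sqrt (d a * (∑ h ∈ s.erase a, mm h) / mm a) / (m - 2) * V s)
    rw [hddef] at key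
    simp only at key
    rw [key]
    have : ∀ b ∈ univ.erase a, -Real.sqrt ((mm a * (mm a - 1) / 2 - κ * mm a) * (∑ h ∈ ({a, b} : Finset (Fin l)).erase a, mm h) / mm a) / (m - 2) * V {a, b}
        = - (e a / (2 * (m - 2))) * (mm b * c a + mm b * c b) := by
      intro b hb
      have hab : a ≠ b := (Finset.ne_of_mem_erase hb).symm
      have h2 := hsq2 a b
      rw [hddef] at h2
      simp only at h2
      rw [er1 a b hab, Finset.sum_singleton, h2, hVab a b hab, ← hrr b]
      have := (hrpos a).ne'
      field_simp
    rw [Finset.sum_congr rfl this, ← Finset.mul_sum, Finset.sum_add_distrib, ← Finset.sum_mul,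
      Finset.sum_erase_eq_sub (mem_univ a), Finset.sum_erase_eq_sub (mem_univ a), hcm, ← hmdef]
    field_simp
    ring
  · obtain ⟨a, b, hab, rfl⟩ := Finset.card_eq_two.1 hs
    rw [hvs]
    have hin : ∑ x, WZMatrix l mm κ (Sum.inr ⟨{a, b}, hs⟩) (Sum.inl x) * (c x * e x)
        = -(e a * r b / r a) / (m - 2) * (c a * e a) + -(e b * r a / r b) / (m - 2) * (c b * e b) := by
      rw [← Finset.add_sum_erase univ _ (mem_univ a),
        ← Finset.add_sum_erase (univ.erase a) _ (show b ∈ univ.erase a by simp [hab.symm]),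
        Finset.sum_eq_zero, add_zero]
      · have h2 := hsq2 a b
        have h2' := hsq2 b a
        rw [hddef] at h2 h2'
        simp only at h2 h2'
        simp only [WZMatrix, ← hmdef, er1 a b hab, er2 a b hab, Finset.sum_singleton, h2, h2',
          mem_insert, mem_singleton, true_or, or_true, if_true]
      · intro x hx
        simp only [mem_erase, mem_univ, and_true] at hx
        simp [WZMatrix, hx.1, hx.2]
    rw [hin]
    obtain ⟨F, hF⟩ : ∃ F : Finset (Fin l) → ℝ, F = fun t =>
      (if ({a, b} : Finset (Fin l)) = t then
          (m - (∑ h ∈ ({a, b} : Finset (Fin l)), mm h) + ∑ h ∈ ({a, b} : Finset (Fin l)), d h / mm h) / (m - 2)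
        else if (({a, b} : Finset (Fin l)) ∩ t).card = 1 then
          -Real.sqrt ((∑ h ∈ ({a, b} : Finset (Fin l)) \ t, mm h) * (∑ h ∈ t \ {a, b}, mm h)) / (2 * (m - 2))
        else 0) * V t := ⟨_, rfl⟩
    have hrow := wz_sum_row a b hab F (by
        rw [hF]
        intro t _ ha hb
        have h1 : ({a, b} : Finset (Fin l)) ≠ t := by rintro rfl; simp at ha
        have h2 : ({a, b} : Finset (Fin l)) ∩ t = ∅ := by
          ext x; simp; rintro (rfl | rfl) <;> assumption
        simp [h1, h2])
    have hout : ∑ x, WZMatrix l mm κ (Sum.inr ⟨{a, b}, hs⟩) (Sum.inr x) * V x.1 =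
        F {a, b} + ∑ k ∈ (univ.erase a).erase b, (F {a, k} + F {b, k}) :=
      Eq.trans (Finset.sum_congr rfl fun t _ => by
        simp only [hF, WZMatrix, ← hmdef, hddef, Subtype.ext_iff]) hrow
    rw [hout]
    have hk : ∀ k ∈ (univ.erase a).erase b, F {a, k} + F {b, k} = -(r a * r b / (4 * (m - 2))) *
          (mm k * (c a + c b) + 2 * (mm k * c k)) := by
      intro k hk
      have hka : k ≠ a := by simp at hk; exact hk.2
      have hkb : k ≠ b := by simp at hk; exact hk.1
      have n1 : ({a, b} : Finset (Fin l)) ≠ {a, k} := by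
        intro h
        have : k ∈ ({a, b} : Finset (Fin l)) := h ▸ (by simp)
        simp [hka, hkb] at this
      have n2 : ({a, b} : Finset (Fin l)) ≠ {b, k} := by
        intro h
        have : k ∈ ({a, b} : Finset (Fin l)) := h ▸ (by simp)
        simp [hka, hkb] at this
      have i1 : ({a, b} : Finset (Fin l)) ∩ {a, k} = {a} := by ext x; simp; grind
      have i2 : ({a, b} : Finset (Fin l)) ∩ {b, k} = {b} := by ext x; simp; grind
      have s1 : ({a, b} : Finset (Fin l)) \ {a, k} = {b} := by ext x; simp; grind
      have s2 : ({a, b} : Finset (Fin l)) \ {b, k} = {a} := by ext x; simp; grind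
      have s3 : ({a, k} : Finset (Fin l)) \ {a, b} = {k} := by ext x; simp; grind
      have s4 : ({b, k} : Finset (Fin l)) \ {a, b} = {k} := by ext x; simp; grind
      simp only [hF, n1, n2, if_false, i1, i2, s1, s2, s3, s4, Finset.card_singleton, if_true,
        Finset.sum_singleton, hsq, hVab a k hka.symm, hVab b k hkb.symm]
      rw [← hrr k]
      field_simp
      ring
    rw [Finset.sum_congr rfl hk, ← Finset.mul_sum, Finset.sum_add_distrib, ← Finset.sum_mul,
      ← Finset.mul_sum]
    have hb' : b ∈ univ.erase a := by simp [hab.symm]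
    rw [Finset.sum_erase_eq_sub hb', Finset.sum_erase_eq_sub hb',
      Finset.sum_erase_eq_sub (mem_univ a), Finset.sum_erase_eq_sub (mem_univ a), hcm, ← hmdef]
    simp only [hF, if_true, Finset.sum_pair hab, hVab a b hab]
    have hdm : ∀ x, d x / mm x = (mm x - 1) / 2 - κ := fun x => by
      have := (hmm x).ne'
      rw [hddef]; field_simp
    have t1 : ∀ x y, e x * r y / r x * e x = (d x / mm x) * (r x * r y) := fun x y => by
      have := (hrpos x).ne'
      rw [← hee, ← hrr]; field_simp
    have e1 : -(e a * r b / r a) / (m - 2) * (c a * e a)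
        = -((mm a - 1) / 2 - κ) * (r a * r b) * c a / (m - 2) := by
      rw [← hdm, neg_mul, ← t1]; ring
    have e2 : -(e b * r a / r b) / (m - 2) * (c b * e b)
        = -((mm b - 1) / 2 - κ) * (r b * r a) * c b / (m - 2) := by
      rw [← hdm, neg_mul, ← t1]; ring
    rw [e1, e2, hdm, hdm]
    field_simp
    ring
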